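/- arXiv:2404.09410 — 2 statements merged into one kernel-verified Lean document; each statement's English description precedes it below -/
import Mathlib

section
/- Let u : ℝ → ℝ be continuously differentiable with u, u' ∈ L²(ℝ, ⟨z⟩^{w} dz) for suitable polynomial weights. For 0 < j < k, define ‖u‖_{Q_j} = ‖∇ʲu · ⟨z⟩^{j + (1-n)/2}‖_{L²(ℝⁿ)}. Then there is a constant C (depending only on n, j) such that ‖u‖_{Q_j}² ≤ C ‖u‖_{Q_{j-1}} (‖u‖_{Q_{j+1}} + ‖u‖_{Q_j}) for all smooth compactly supported u. -/
open MeasureTheory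

/-- The weighted seminorm `‖u‖_{Q_j} = ‖∇ʲu ⟨z⟩^{j+(1-n)/2}‖_{L²}`. -/
noncomputable def Qnorm (n j : ℕ) (u : EuclideanSpace ℝ (Fin n) → ℝ) : ℝ :=
  (∫ z : EuclideanSpace ℝ (Fin n),
      ‖iteratedFDeriv ℝ j u z‖ ^ 2 * (1 + ‖z‖ ^ 2) ^ ((j : ℝ) + (1 - (n : ℝ)) / 2))
    ^ ((1 : ℝ) / 2)

lemma aux_opnorm (n k : ℕ)
    (T : ContinuousMultilinearMap ℝ (fun _ : Fin k => EuclideanSpace ℝ (Fin n)) ℝ) :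
    ‖T‖ ≤ ∑ s : Fin k → Fin n, |T (fun i => EuclideanSpace.basisFun (Fin n) ℝ (s i))| := by
  refine ContinuousMultilinearMap.opNorm_le_bound
    (Finset.sum_nonneg fun _ _ => abs_nonneg _) ?_
  intro x
  have hx : x = fun i => ∑ l : Fin n, (x i l) • EuclideanSpace.basisFun (Fin n) ℝ l := by
    funext i
    have := (EuclideanSpace.basisFun (Fin n) ℝ).sum_repr (x i)
    simpa using this.symm
  have h1 : T x = ∑ s : Fin k → Fin n,
      (∏ i, x i (s i)) • T (fun i => EuclideanSpace.basisFun (Fin n) ℝ (s i)) := by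
    conv_lhs => rw [hx]
    rw [ContinuousMultilinearMap.map_sum]
    refine Finset.sum_congr rfl fun s _ => ?_
    exact ContinuousMultilinearMap.map_smul_univ T _ _
  rw [h1, Finset.sum_mul]
  refine (norm_sum_le _ _).trans (Finset.sum_le_sum fun s _ => ?_)
  rw [norm_smul, mul_comm, Real.norm_eq_abs]
  refine mul_le_mul_of_nonneg_left ?_ (abs_nonneg _)
  rw [norm_prod]
  exact Finset.prod_le_prod (fun _ _ => norm_nonneg _) fun i _ => PiLp.norm_apply_le (x i) (s i)

lemma aux_pos {n : ℕ} (z : EuclideanSpace ℝ (Fin n)) : 0 < 1 + ‖z‖ ^ 2 := by positivity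

lemma aux_wcont (n : ℕ) (p : ℝ) :
    Continuous fun z : EuclideanSpace ℝ (Fin n) => (1 + ‖z‖ ^ 2) ^ p := by
  refine Continuous.rpow_const (by fun_prop) fun z => Or.inl (aux_pos z).ne'

lemma aux_cs (n : ℕ) (a b : EuclideanSpace ℝ (Fin n) → ℝ) (ha : Continuous a)
    (hb : Continuous b) (has : HasCompactSupport a) (hbs : HasCompactSupport b)
    (ha0 : ∀ z, 0 ≤ a z) (hb0 : ∀ z, 0 ≤ b z) (p q r : ℝ) (h : p + q = 2 * r) :
    ∫ z, a z * b z * (1 + ‖z‖ ^ 2) ^ r ≤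
      (∫ z, a z ^ 2 * (1 + ‖z‖ ^ 2) ^ p) ^ ((1 : ℝ) / 2) *
        (∫ z, b z ^ 2 * (1 + ‖z‖ ^ 2) ^ q) ^ ((1 : ℝ) / 2) := by
  have key := integral_mul_le_Lp_mul_Lq_of_nonneg (μ := (volume : Measure (EuclideanSpace ℝ (Fin n))))
    Real.HolderConjugate.two_two
    (f := fun z => a z * (1 + ‖z‖ ^ 2) ^ (p / 2)) (g := fun z => b z * (1 + ‖z‖ ^ 2) ^ (q / 2))
    (Filter.Eventually.of_forall fun z => mul_nonneg (ha0 z) (Real.rpow_nonneg (aux_pos z).le _))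
    (Filter.Eventually.of_forall fun z => mul_nonneg (hb0 z) (Real.rpow_nonneg (aux_pos z).le _))
    ((ha.mul (aux_wcont n _)).memLp_of_hasCompactSupport has.mul_right)
    ((hb.mul (aux_wcont n _)).memLp_of_hasCompactSupport hbs.mul_right)
  have e1 : ∀ (c p : ℝ) (z : EuclideanSpace ℝ (Fin n)),
      (c * (1 + ‖z‖ ^ 2) ^ (p / 2)) ^ (2 : ℝ) = c ^ 2 * (1 + ‖z‖ ^ 2) ^ p := by
    intro c p z
    rw [Real.rpow_two, mul_pow, ← Real.rpow_natCast ((1 + ‖z‖ ^ 2) ^ (p / 2)) 2,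
      ← Real.rpow_mul (aux_pos z).le]
    norm_num
  have e2 : ∀ z : EuclideanSpace ℝ (Fin n),
      (a z * (1 + ‖z‖ ^ 2) ^ (p / 2)) * (b z * (1 + ‖z‖ ^ 2) ^ (q / 2)) =
        a z * b z * (1 + ‖z‖ ^ 2) ^ r := by
    intro z
    have : r = p / 2 + q / 2 := by linarith
    rw [this, Real.rpow_add (aux_pos z)]
    ring
  simpa only [e1, e2] using key

lemma aux_wderiv (n : ℕ) (p : ℝ) (z : EuclideanSpace ℝ (Fin n)) :
    HasFDerivAt (fun z : EuclideanSpace ℝ (Fin n) => (1 + ‖z‖ ^ 2) ^ p)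
      ((p * (1 + ‖z‖ ^ 2) ^ (p - 1)) • (2 • innerSL ℝ z)) z := by
  have h := ((hasStrictFDerivAt_norm_sq z).hasFDerivAt.const_add 1).rpow_const (p := p)
    (Or.inl (aux_pos z).ne')
  exact h

lemma aux_wbound (n : ℕ) (p : ℝ) (z e : EuclideanSpace ℝ (Fin n)) (he : ‖e‖ = 1) :
    |((p * (1 + ‖z‖ ^ 2) ^ (p - 1)) • (2 • innerSL ℝ z)) e| ≤
      2 * |p| * (1 + ‖z‖ ^ 2) ^ (p - 1 / 2) := by
  have hp := aux_pos z
  have h1 : |inner ℝ z e| ≤ (1 + ‖z‖ ^ 2) ^ ((1 : ℝ) / 2) := by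
    refine (abs_real_inner_le_norm z e).trans ?_
    rw [he, mul_one, ← Real.sqrt_eq_rpow]
    exact Real.le_sqrt_of_sq_le (by linarith)
  have h2 : (1 + ‖z‖ ^ 2) ^ (p - 1 / 2) =
      (1 + ‖z‖ ^ 2) ^ (p - 1) * (1 + ‖z‖ ^ 2) ^ ((1 : ℝ) / 2) := by
    rw [← Real.rpow_add hp]; congr 1; ring
  have h3 : ((p * (1 + ‖z‖ ^ 2) ^ (p - 1)) • (2 • innerSL ℝ z)) e =
      p * (1 + ‖z‖ ^ 2) ^ (p - 1) * (2 * inner ℝ z e) := by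
    simp
  have h4 : 0 ≤ (1 + ‖z‖ ^ 2) ^ (p - 1) := Real.rpow_nonneg hp.le _
  rw [h3, h2, abs_mul, abs_mul, abs_mul, abs_of_nonneg h4, abs_two]
  have := mul_le_mul_of_nonneg_left h1 (mul_nonneg (abs_nonneg p) h4)
  nlinarith

lemma aux_evderiv (n k : ℕ) (u : EuclideanSpace ℝ (Fin n) → ℝ) (hu : ContDiff ℝ (⊤ : ℕ∞) u)
    (v : Fin k → EuclideanSpace ℝ (Fin n)) (z : EuclideanSpace ℝ (Fin n)) :
    ∃ L : EuclideanSpace ℝ (Fin n) →L[ℝ] ℝ,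
      HasFDerivAt (fun z => iteratedFDeriv ℝ k u z v) L z ∧
      ∀ e, L e = iteratedFDeriv ℝ (k + 1) u z (Fin.cons e v) := by
  have hd : DifferentiableAt ℝ (iteratedFDeriv ℝ k u) z :=
    (hu.differentiable_iteratedFDeriv (by exact_mod_cast WithTop.coe_lt_top k)) z
  refine ⟨_, (ContinuousMultilinearMap.apply ℝ (fun _ : Fin k => EuclideanSpace ℝ (Fin n)) ℝ
    v).hasFDerivAt.comp z hd.hasFDerivAt, fun e => ?_⟩
  rw [iteratedFDeriv_succ_apply_left]
  simp

lemma aux_evbound (n k : ℕ) (u : EuclideanSpace ℝ (Fin n) → ℝ)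
    (v : Fin k → EuclideanSpace ℝ (Fin n)) (hv : ∀ i, ‖v i‖ = 1) (z : EuclideanSpace ℝ (Fin n)) :
    |iteratedFDeriv ℝ k u z v| ≤ ‖iteratedFDeriv ℝ k u z‖ := by
  simpa [hv] using (iteratedFDeriv ℝ k u z).le_opNorm v

lemma aux_evcont (n k : ℕ) (u : EuclideanSpace ℝ (Fin n) → ℝ) (hu : ContDiff ℝ (⊤ : ℕ∞) u)
    (v : Fin k → EuclideanSpace ℝ (Fin n)) : Continuous fun z => iteratedFDeriv ℝ k u z v :=
  (ContinuousMultilinearMap.apply ℝ (fun _ : Fin k => EuclideanSpace ℝ (Fin n)) ℝ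
    v).continuous.comp (hu.continuous_iteratedFDeriv (by exact_mod_cast le_top))

lemma aux_evsupp (n k : ℕ) (u : EuclideanSpace ℝ (Fin n) → ℝ) (hs : HasCompactSupport u)
    (v : Fin k → EuclideanSpace ℝ (Fin n)) :
    HasCompactSupport fun z => iteratedFDeriv ℝ k u z v :=
  (hs.iteratedFDeriv (𝕜 := ℝ) k).comp_left
    (g := fun T : ContinuousMultilinearMap ℝ
      (fun _ : Fin k => EuclideanSpace ℝ (Fin n)) ℝ => T v) (by simp)

lemma aux_main (n m : ℕ) (p : ℝ) (u : EuclideanSpace ℝ (Fin n) → ℝ)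
    (hu : ContDiff ℝ (⊤ : ℕ∞) u) (hs : HasCompactSupport u)
    (v : Fin m → EuclideanSpace ℝ (Fin n)) (hv : ∀ i, ‖v i‖ = 1)
    (e : EuclideanSpace ℝ (Fin n)) (he : ‖e‖ = 1) :
    ∫ z, (iteratedFDeriv ℝ (m + 1) u z (Fin.cons e v)) ^ 2 * (1 + ‖z‖ ^ 2) ^ p ≤
      (∫ z, ‖iteratedFDeriv ℝ m u z‖ * ‖iteratedFDeriv ℝ (m + 2) u z‖ * (1 + ‖z‖ ^ 2) ^ p) +
      2 * |p| * ∫ z, ‖iteratedFDeriv ℝ m u z‖ * ‖iteratedFDeriv ℝ (m + 1) u z‖ *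
        (1 + ‖z‖ ^ 2) ^ (p - 1 / 2) := by
  set w : Fin (m + 1) → EuclideanSpace ℝ (Fin n) := Fin.cons e v with hw
  have hw1 : ∀ i, ‖w i‖ = 1 := by
    intro i; refine Fin.cases ?_ (fun i => ?_) i <;> simp [hw, he, hv]
  set x : Fin (m + 2) → EuclideanSpace ℝ (Fin n) := Fin.cons e w with hx
  have hx1 : ∀ i, ‖x i‖ = 1 := by
    intro i; refine Fin.cases ?_ (fun i => ?_) i <;> simp [hx, he, hw1]
  set W : EuclideanSpace ℝ (Fin n) → ℝ := fun z => (1 + ‖z‖ ^ 2) ^ p with hW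
  set W' : EuclideanSpace ℝ (Fin n) → ℝ :=
    fun z => ((p * (1 + ‖z‖ ^ 2) ^ (p - 1)) • (2 • innerSL ℝ z)) e with hW'
  set f := fun z => iteratedFDeriv ℝ m u z v with hf
  set f1 := fun z => iteratedFDeriv ℝ (m + 1) u z w with hf1
  set f2 := fun z => iteratedFDeriv ℝ (m + 2) u z x with hf2
  have cf : Continuous f := aux_evcont n m u hu v
  have cf1 : Continuous f1 := aux_evcont n (m + 1) u hu w
  have cf2 : Continuous f2 := aux_evcont n (m + 2) u hu x
  have sf : HasCompactSupport f := aux_evsupp n m u hs v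
  have sf1 : HasCompactSupport f1 := aux_evsupp n (m + 1) u hs w
  have cW : Continuous W := aux_wcont n p
  have cW' : Continuous W' := by
    have : W' = fun z => p * (1 + ‖z‖ ^ 2) ^ (p - 1) * (2 * inner ℝ z e) := by
      funext z; simp [hW']
    rw [this]
    exact (continuous_const.mul (aux_wcont n _)).mul (by fun_prop)
  have df : ∀ z, DifferentiableAt ℝ f z := fun z => by
    obtain ⟨L, h, -⟩ := aux_evderiv n m u hu v z
    exact h.differentiableAt
  have df' : ∀ z, fderiv ℝ f z e = f1 z := fun z => by
    obtain ⟨L, h, h'⟩ := aux_evderiv n m u hu v z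
    rw [h.fderiv, h']
  have dg : ∀ z, DifferentiableAt ℝ (fun z => f1 z * W z) z := fun z => by
    obtain ⟨L, h, -⟩ := aux_evderiv n (m + 1) u hu w z
    exact (h.mul (aux_wderiv n p z)).differentiableAt
  have dg' : ∀ z, fderiv ℝ (fun z => f1 z * W z) z e = f1 z * W' z + W z * f2 z := fun z => by
    obtain ⟨L, h, h'⟩ := aux_evderiv n (m + 1) u hu w z
    have h2 : HasFDerivAt (fun z => f1 z * W z) _ z := h.mul (aux_wderiv n p z)
    rw [h2.fderiv]
    have h3 : f2 z = L e := (h' e).symm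
    rw [h3]
    rfl
  have ibp := integral_mul_fderiv_eq_neg_fderiv_mul_of_integrable
    (μ := (volume : Measure (EuclideanSpace ℝ (Fin n)))) (f := f) (g := fun z => f1 z * W z)
    (v := e)
    (by
      simp only [df']
      exact (cf1.mul (cf1.mul cW)).integrable_of_hasCompactSupport sf1.mul_right)
    (by
      simp only [dg']
      exact (cf.mul ((cf1.mul cW').add (cW.mul cf2))).integrable_of_hasCompactSupport sf.mul_right)
    ((cf.mul (cf1.mul cW)).integrable_of_hasCompactSupport sf.mul_right)
    (fun z _ => df z) (fun z _ => dg z)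
  simp only [df', dg'] at ibp
  have cn : ∀ k, Continuous fun z => ‖iteratedFDeriv ℝ k u z‖ := fun k =>
    (hu.continuous_iteratedFDeriv (by exact_mod_cast le_top)).norm
  have sn : HasCompactSupport fun z => ‖iteratedFDeriv ℝ m u z‖ := (hs.iteratedFDeriv (𝕜 := ℝ) m).norm
  have i1 : Integrable (fun z => ‖iteratedFDeriv ℝ m u z‖ * ‖iteratedFDeriv ℝ (m + 2) u z‖ *
      (1 + ‖z‖ ^ 2) ^ p) :=
    (((cn m).mul (cn (m + 2))).mul cW).integrable_of_hasCompactSupport sn.mul_right.mul_right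
  have i2 : Integrable (fun z => ‖iteratedFDeriv ℝ m u z‖ * ‖iteratedFDeriv ℝ (m + 1) u z‖ *
      (1 + ‖z‖ ^ 2) ^ (p - 1 / 2)) :=
    (((cn m).mul (cn (m + 1))).mul (aux_wcont n _)).integrable_of_hasCompactSupport
      sn.mul_right.mul_right
  have i3 : Integrable (fun z => f z * (f1 z * W' z + W z * f2 z)) :=
    (cf.mul ((cf1.mul cW').add (cW.mul cf2))).integrable_of_hasCompactSupport sf.mul_right
  have l : ∫ z, f1 z ^ 2 * (1 + ‖z‖ ^ 2) ^ p = ∫ z, -(f z * (f1 z * W' z + W z * f2 z)) := by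
    rw [integral_neg, ibp, neg_neg]
    refine integral_congr_ae (Filter.Eventually.of_forall fun z => ?_)
    simp only [hW]; ring
  rw [l, ← integral_const_mul, ← integral_add i1 (i2.const_mul _)]
  refine integral_mono i3.neg (i1.add (i2.const_mul _)) fun z => ?_
  have b0 : |f z| ≤ _ := aux_evbound n m u v hv z
  have b1 : |f1 z| ≤ _ := aux_evbound n (m + 1) u w hw1 z
  have b2 : |f2 z| ≤ _ := aux_evbound n (m + 2) u x hx1 z
  have b3 : |W' z| ≤ _ := aux_wbound n p z e he
  have b4 : 0 ≤ W z := Real.rpow_nonneg (aux_pos z).le _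
  have hab : |f z * (f1 z * W' z + W z * f2 z)| ≤ |f z| * |f2 z| * W z + |f z| * |f1 z| * |W' z| := by
    have : f z * (f1 z * W' z + W z * f2 z) = f z * f2 z * W z + f z * f1 z * W' z := by ring
    rw [this]
    refine (abs_add_le _ _).trans ?_
    rw [abs_mul, abs_mul, abs_mul, abs_mul, abs_of_nonneg b4]
  refine (neg_le_abs _).trans (hab.trans ?_)
  have c1 : |f z| * |f2 z| * W z ≤ ‖iteratedFDeriv ℝ m u z‖ * ‖iteratedFDeriv ℝ (m + 2) u z‖ * W z := by
    gcongr
  have c2 : |f z| * |f1 z| * |W' z| ≤ ‖iteratedFDeriv ℝ m u z‖ * ‖iteratedFDeriv ℝ (m + 1) u z‖ *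
      (2 * |p| * (1 + ‖z‖ ^ 2) ^ (p - 1 / 2)) := by
    gcongr
  refine (add_le_add c1 c2).trans (le_of_eq ?_)
  simp only [hW]; ring

/-- Interpolation step: `‖u‖_{Q_j}² ≤ C ‖u‖_{Q_{j-1}} (‖u‖_{Q_{j+1}} + ‖u‖_{Q_j})`
for smooth compactly supported `u` and `0 < j`. -/
theorem interpolation_step (n j : ℕ) (hn : 1 ≤ n) (hj : 0 < j) :
    ∃ C > 0, ∀ u : EuclideanSpace ℝ (Fin n) → ℝ,
      ContDiff ℝ (⊤ : ℕ∞) u → HasCompactSupport u →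
      Qnorm n j u ^ 2 ≤ C * Qnorm n (j - 1) u * (Qnorm n (j + 1) u + Qnorm n j u) := by
  obtain ⟨m, rfl⟩ : ∃ m, j = m + 1 := ⟨j - 1, by omega⟩
  simp only [Nat.add_sub_cancel]
  set p : ℝ := ((m + 1 : ℕ) : ℝ) + (1 - (n : ℝ)) / 2 with hp
  set N : ℝ := (Fintype.card (Fin (m + 1) → Fin n) : ℝ) with hN
  have hN0 : 0 ≤ N := by positivity
  refine ⟨N * N * (1 + 2 * |p|) + 1, by positivity, fun u hu hs => ?_⟩
  have cn : ∀ k, Continuous fun z => ‖iteratedFDeriv ℝ k u z‖ := fun k =>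
    (hu.continuous_iteratedFDeriv (by exact_mod_cast le_top)).norm
  have sn : ∀ k, HasCompactSupport fun z => ‖iteratedFDeriv ℝ k u z‖ := fun k =>
    (hs.iteratedFDeriv (𝕜 := ℝ) k).norm
  have Q0 : ∀ k, 0 ≤ Qnorm n k u := fun k => Real.rpow_nonneg (integral_nonneg fun z =>
    mul_nonneg (sq_nonneg _) (Real.rpow_nonneg (aux_pos z).le _)) _
  have cs1 : ∫ z, ‖iteratedFDeriv ℝ m u z‖ * ‖iteratedFDeriv ℝ (m + 2) u z‖ *
      (1 + ‖z‖ ^ 2) ^ p ≤ Qnorm n m u * Qnorm n (m + 2) u :=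
    aux_cs n _ _ (cn m) (cn (m + 2)) (sn m) (sn (m + 2)) (fun _ => norm_nonneg _)
      (fun _ => norm_nonneg _) _ _ _ (by rw [hp]; push_cast; ring)
  have cs2 : ∫ z, ‖iteratedFDeriv ℝ m u z‖ * ‖iteratedFDeriv ℝ (m + 1) u z‖ *
      (1 + ‖z‖ ^ 2) ^ (p - 1 / 2) ≤ Qnorm n m u * Qnorm n (m + 1) u :=
    aux_cs n _ _ (cn m) (cn (m + 1)) (sn m) (sn (m + 1)) (fun _ => norm_nonneg _)
      (fun _ => norm_nonneg _) _ _ _ (by rw [hp]; push_cast; ring)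
  set R := Qnorm n m u * Qnorm n (m + 2) u + 2 * |p| * (Qnorm n m u * Qnorm n (m + 1) u) with hR
  have hsq : Qnorm n (m + 1) u ^ 2 =
      ∫ z, ‖iteratedFDeriv ℝ (m + 1) u z‖ ^ 2 * (1 + ‖z‖ ^ 2) ^ p := by
    rw [Qnorm, ← Real.sqrt_eq_rpow, Real.sq_sqrt]
    exact integral_nonneg fun z =>
      mul_nonneg (sq_nonneg _) (Real.rpow_nonneg (aux_pos z).le _)
  let E : (Fin (m + 1) → Fin n) → Fin (m + 1) → EuclideanSpace ℝ (Fin n) :=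
    fun s i => EuclideanSpace.basisFun (Fin n) ℝ (s i)
  have hE : ∀ s i, ‖E s i‖ = 1 := fun s i => (EuclideanSpace.basisFun (Fin n) ℝ).norm_eq_one _
  have each : ∀ s, ∫ z, (iteratedFDeriv ℝ (m + 1) u z (E s)) ^ 2 * (1 + ‖z‖ ^ 2) ^ p ≤ R := by
    intro s
    have h := aux_main n m p u hu hs (Fin.tail (E s)) (fun i => hE s _) (E s 0) (hE s 0)
    rw [Fin.cons_self_tail] at h
    refine h.trans ?_
    rw [hR]
    gcongr
  have ints : ∀ s, Integrable fun z =>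
      (iteratedFDeriv ℝ (m + 1) u z (E s)) ^ 2 * (1 + ‖z‖ ^ 2) ^ p := by
    intro s
    have c := aux_evcont n (m + 1) u hu (E s)
    have hsup := aux_evsupp n (m + 1) u hs (E s)
    simp only [pow_two (iteratedFDeriv ℝ (m + 1) u _ (E s))]
    exact ((c.mul c).mul (aux_wcont n p)).integrable_of_hasCompactSupport
      hsup.mul_right.mul_right
  have step : Qnorm n (m + 1) u ^ 2 ≤ N * (N * R) := by
    calc Qnorm n (m + 1) u ^ 2
        ≤ ∫ z, N * ∑ s, (iteratedFDeriv ℝ (m + 1) u z (E s)) ^ 2 * (1 + ‖z‖ ^ 2) ^ p := by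
          rw [hsq]
          refine integral_mono ?_ ((integrable_finsetSum _ fun s _ => ints s).const_mul _) ?_
          · simp only [pow_two ‖iteratedFDeriv ℝ (m + 1) u _‖]
            exact (((cn (m + 1)).mul (cn (m + 1))).mul
              (aux_wcont n p)).integrable_of_hasCompactSupport (sn (m + 1)).mul_right.mul_right
          · intro z
            have h1 := aux_opnorm n (m + 1) (iteratedFDeriv ℝ (m + 1) u z)
            have h2 := pow_le_pow_left₀ (norm_nonneg _) h1 2
            have h3 := h2.trans sq_sum_le_card_mul_sum_sq
            simp only [sq_abs, Finset.card_univ] at h3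
            have h4 := mul_le_mul_of_nonneg_right h3 (Real.rpow_nonneg (aux_pos z).le p)
            refine h4.trans (le_of_eq ?_)
            rw [mul_assoc, Finset.sum_mul]
      _ = N * ∑ s, ∫ z, (iteratedFDeriv ℝ (m + 1) u z (E s)) ^ 2 * (1 + ‖z‖ ^ 2) ^ p := by
          rw [integral_const_mul, integral_finsetSum _ fun s _ => ints s]
      _ ≤ N * (N * R) := by
          refine mul_le_mul_of_nonneg_left ?_ hN0
          refine (Finset.sum_le_sum fun s _ => each s).trans (le_of_eq ?_)
          simp [hN]
  refine step.trans ?_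
  have a0 := Q0 m
  have a1 := Q0 (m + 1)
  have a2 := Q0 (m + 1 + 1)
  have hA := abs_nonneg p
  change N * (N * (Qnorm n m u * Qnorm n (m + 1 + 1) u +
    2 * |p| * (Qnorm n m u * Qnorm n (m + 1) u))) ≤ _
  have e1 : 0 ≤ Qnorm n m u * Qnorm n (m + 1 + 1) u := mul_nonneg a0 a2
  have e2 : 0 ≤ Qnorm n m u * Qnorm n (m + 1) u := mul_nonneg a0 a1
  have e3 : 0 ≤ N * N := mul_nonneg hN0 hN0
  have e4 := mul_nonneg (mul_nonneg e3 hA) e1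
  have e5 := mul_nonneg e3 e2
  nlinarith
end

section
/- Let n ≥ 1, k ≥ 2. For smooth compactly supported u : ℝⁿ → ℝ, the weighted norm of the product satisfies ‖∇^{k-j}u · ∇ʲu‖_{L²(ρ_k)} ≤ C (‖u‖_{Q_k} + ‖u‖_{Q_0})² for all 0 ≤ j ≤ k/2, where ρ_k(z) = 1 + 10^{-3k}|z|^{2k+1-n} and k = 2n+10. -/
open MeasureTheory

open scoped ENNReal

lemma aux_cs_s11 {α : Type*} [MeasurableSpace α] (μ : Measure α) (f g : α → ℝ≥0∞)
    (hf : AEMeasurable f μ) (hg : AEMeasurable g μ) :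
    (∫⁻ a, f a * g a ∂μ) ^ 2 ≤ (∫⁻ a, f a ^ 2 ∂μ) * (∫⁻ a, g a ^ 2 ∂μ) := by
  have h := ENNReal.lintegral_mul_le_Lp_mul_Lq μ Real.HolderConjugate.two_two hf hg
  simp only [Pi.mul_apply] at h
  have h2 : ∀ x : ℝ≥0∞, (x ^ (1 / (2:ℝ))) ^ 2 = x := fun x => by
    rw [← ENNReal.rpow_natCast, ← ENNReal.rpow_mul]; norm_num
  calc (∫⁻ a, f a * g a ∂μ) ^ 2 ≤ _ := pow_le_pow_left' h 2
    _ = _ := by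
      rw [mul_pow, h2, h2]
      simp only [ENNReal.rpow_ofNat]

lemma aux_ici {F : Type*} [NormedAddCommGroup F] [NormedSpace ℝ F]
    {f : ℝ → F} (hf : ContDiff ℝ 1 f) (hfc : HasCompactSupport f) (x : ℝ) :
    ‖f x‖ₑ ≤ ∫⁻ y in Set.Ici x, ‖deriv f y‖ₑ := by
  have h := HasCompactSupport.enorm_le_lintegral_Ici_deriv (f := fun y => f (-y))
    (hf.comp contDiff_neg) (hfc.comp_homeomorph (Homeomorph.neg ℝ)) (-x)
  rw [neg_neg] at h
  refine h.trans (le_of_eq ?_)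
  have e := (Measure.measurePreserving_neg (volume : Measure ℝ)).setLIntegral_comp_preimage_emb
    (MeasurableEquiv.neg ℝ).measurableEmbedding (fun y => ‖deriv f y‖ₑ) (Set.Ici x)
  rw [← e]
  have : Neg.neg ⁻¹' Set.Ici x = Set.Iic (-x) := by ext; simp
  rw [this]
  congr 1
  ext y
  rw [deriv_comp_neg, enorm_neg]

lemma aux_out {F : Type*} [NormedAddCommGroup F] [NormedSpace ℝ F]
    {f : ℝ → F} (hf : ContDiff ℝ 1 f) (hfc : HasCompactSupport f) (w : ℝ → ℝ≥0∞)
    (hw : ∀ s t, |s| ≤ |t| → w s ≤ w t) (x : ℝ) :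
    w x * ‖f x‖ₑ ≤ ∫⁻ y, w y * ‖deriv f y‖ₑ := by
  rcases le_total 0 x with hx | hx
  · calc w x * ‖f x‖ₑ ≤ w x * ∫⁻ y in Set.Ici x, ‖deriv f y‖ₑ := by gcongr; exact aux_ici hf hfc x
      _ ≤ ∫⁻ y in Set.Ici x, w x * ‖deriv f y‖ₑ := lintegral_const_mul_le _ _
      _ ≤ ∫⁻ y in Set.Ici x, w y * ‖deriv f y‖ₑ := by
        refine setLIntegral_mono' measurableSet_Ici fun y hy => ?_
        gcongr
        apply hw
        rw [abs_of_nonneg hx, abs_of_nonneg (hx.trans hy)]; exact hy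
      _ ≤ _ := setLIntegral_le_lintegral _ _
  · calc w x * ‖f x‖ₑ ≤ w x * ∫⁻ y in Set.Iic x, ‖deriv f y‖ₑ := by
          gcongr; exact HasCompactSupport.enorm_le_lintegral_Ici_deriv hf hfc x
      _ ≤ ∫⁻ y in Set.Iic x, w x * ‖deriv f y‖ₑ := lintegral_const_mul_le _ _
      _ ≤ ∫⁻ y in Set.Iic x, w y * ‖deriv f y‖ₑ := by
        refine setLIntegral_mono' measurableSet_Iic fun y hy => ?_
        gcongr
        apply hw
        have hy' : y ≤ x := hy
        rw [abs_of_nonpos hx, abs_of_nonpos (hy'.trans hx)]; linarith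
      _ ≤ _ := setLIntegral_le_lintegral _ _

lemma aux_step (n m : ℕ) (q : ℝ) (hq : 0 ≤ q) (u : EuclideanSpace ℝ (Fin n) → ℝ)
    (hu : ContDiff ℝ (⊤ : ℕ∞) u) (hc : HasCompactSupport u) (i : Fin n) (y : Fin n → ℝ) :
    ENNReal.ofReal ((1 + ‖WithLp.toLp 2 y‖ ^ 2) ^ q) * ‖iteratedFDeriv ℝ m u (WithLp.toLp 2 y)‖ₑ
    ≤ ∫⁻ t : ℝ, ENNReal.ofReal ((1 + ‖WithLp.toLp 2 (Function.update y i t)‖ ^ 2) ^ q) *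
        ‖iteratedFDeriv ℝ (m + 1) u (WithLp.toLp 2 (Function.update y i t))‖ₑ := by
  set e : ℝ → EuclideanSpace ℝ (Fin n) := fun t => WithLp.toLp 2 (Function.update y i t) with he
  have he' : ∀ t, e t = WithLp.toLp 2 y + (t - y i) • EuclideanSpace.single i (1:ℝ) := by
    intro t
    ext l
    by_cases h : l = i
    · subst h; simp [he]
    · simp [he, h]
  have hd : ContDiff ℝ 1 e := by
    rw [funext he']; fun_prop
  have hD : ContDiff ℝ 1 (iteratedFDeriv ℝ m u) :=
    hu.iteratedFDeriv_right (by exact_mod_cast le_top)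
  have hde : ∀ t, HasDerivAt e (EuclideanSpace.single i (1:ℝ)) t := by
    intro t
    rw [funext he']
    simpa using (((hasDerivAt_id t).sub_const (y i)).smul_const
      (EuclideanSpace.single i (1:ℝ))).const_add (WithLp.toLp 2 y)
  have hcl : Topology.IsClosedEmbedding e := by
    have : e = (fun z => (WithLp.toLp 2 y - (y i) • EuclideanSpace.single i (1:ℝ)) + z) ∘
        fun t : ℝ => t • EuclideanSpace.single i (1:ℝ) := by
      funext t; rw [he' t]; simp only [Function.comp, sub_smul]; abel
    rw [this]
    exact (Homeomorph.addLeft _).isClosedEmbedding.comp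
      (isClosedEmbedding_smul_left (by simp))
  have key := aux_out (f := fun t => iteratedFDeriv ℝ m u (e t)) (hD.comp hd)
    ((hc.iteratedFDeriv m).comp_isClosedEmbedding hcl)
    (fun t => ENNReal.ofReal ((1 + ‖e t‖ ^ 2) ^ q)) ?_ (y i)
  · have hy : e (y i) = WithLp.toLp 2 y := by simp [he]
    simp only [hy] at key
    refine key.trans (lintegral_mono fun t => ?_)
    gcongr
    have h1 : HasDerivAt (fun t => iteratedFDeriv ℝ m u (e t))
        (fderiv ℝ (iteratedFDeriv ℝ m u) (e t) (EuclideanSpace.single i (1:ℝ))) t :=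
      ((hD.differentiable one_ne_zero (e t)).hasFDerivAt).comp_hasDerivAt t (hde t)
    rw [h1.deriv, enorm_le_iff_norm_le, ← norm_fderiv_iteratedFDeriv]
    refine (ContinuousLinearMap.le_opNorm _ _).trans (by simp [he])
  · intro s t hst
    apply ENNReal.ofReal_le_ofReal
    apply Real.rpow_le_rpow (by positivity) _ hq
    rw [EuclideanSpace.norm_sq_eq, EuclideanSpace.norm_sq_eq]
    gcongr with l
    by_cases h : l = i
    · subst h; simpa [he] using hst
    · simp [he, h]

lemma aux_meas (n m : ℕ) (q : ℝ) (u : EuclideanSpace ℝ (Fin n) → ℝ)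
    (hu : ContDiff ℝ (⊤ : ℕ∞) u) :
    Measurable fun z => ENNReal.ofReal ((1 + ‖z‖ ^ 2) ^ q) * ‖iteratedFDeriv ℝ m u z‖ₑ := by
  have h1 : Continuous (iteratedFDeriv ℝ m u) := hu.continuous_iteratedFDeriv (by exact_mod_cast le_top)
  have h2 : Measurable fun z => ‖iteratedFDeriv ℝ m u z‖ₑ := h1.enorm.measurable
  fun_prop

lemma aux_sup (n j : ℕ) (q : ℝ) (hq : 0 ≤ q) (u : EuclideanSpace ℝ (Fin n) → ℝ)
    (hu : ContDiff ℝ (⊤ : ℕ∞) u) (hc : HasCompactSupport u) (x : EuclideanSpace ℝ (Fin n)) :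
    ENNReal.ofReal ((1 + ‖x‖ ^ 2) ^ q) * ‖iteratedFDeriv ℝ j u x‖ₑ
    ≤ ∫⁻ z, ENNReal.ofReal ((1 + ‖z‖ ^ 2) ^ q) * ‖iteratedFDeriv ℝ (j + n) u z‖ₑ := by
  set V : ℕ → (Fin n → ℝ) → ℝ≥0∞ := fun m y =>
    ENNReal.ofReal ((1 + ‖WithLp.toLp 2 y‖ ^ 2) ^ q) *
      ‖iteratedFDeriv ℝ (j + m) u (WithLp.toLp 2 y)‖ₑ with hV
  have hVm : ∀ m, Measurable (V m) := fun m =>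
    (aux_meas n (j + m) q u hu).comp (WithLp.measurable_toLp 2 _)
  have main : ∀ s : Finset (Fin n), V 0 ≤ lmarginal (fun _ => volume) s (V s.card) := by
    intro s
    induction s using Finset.induction_on with
    | empty => simp
    | insert i s hi ih =>
      rw [Finset.card_insert_of_notMem hi, lmarginal_insert' _ (hVm _) hi]
      exact ih.trans (lmarginal_mono fun y => aux_step n (j + s.card) q hq u hu hc i y)
  have h := main Finset.univ (WithLp.ofLp x)
  rw [lmarginal_univ, Finset.card_univ, Fintype.card_fin] at h
  refine h.trans (le_of_eq ?_)
  exact (PiLp.volume_preserving_toLp (Fin n)).lintegral_comp (aux_meas n (j + n) q u hu)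

lemma aux_weight (d p s t : ℝ) (hd : 0 ≤ d) (hp : 0 ≤ p + d / 2) (hs : 1 ≤ s) :
    t ^ 2 * (1 + t ^ 2) ^ p ≤ s ^ (d - 2) * (1 + (s * t) ^ 2) ^ (p + 1) := by
  have hs0 : 0 < s := by linarith
  have hA : 0 < 1 + t ^ 2 := by positivity
  have hB : 0 < 1 + (s * t) ^ 2 := by positivity
  have hs2 : 1 ≤ s ^ 2 := by nlinarith
  have hAB : 1 + t ^ 2 ≤ 1 + (s * t) ^ 2 := by nlinarith [sq_nonneg t]
  have hBA : 1 + (s * t) ^ 2 ≤ s ^ 2 * (1 + t ^ 2) := by nlinarith [sq_nonneg t]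
  set A := 1 + t ^ 2
  set B := 1 + (s * t) ^ 2
  have h1 : A ^ (p + d / 2) ≤ B ^ (p + d / 2) := Real.rpow_le_rpow hA.le hAB hp
  have h2 : B ^ (d / 2) ≤ s ^ d * A ^ (d / 2) := by
    calc B ^ (d / 2) ≤ (s ^ 2 * A) ^ (d / 2) := Real.rpow_le_rpow hB.le hBA (by positivity)
      _ = s ^ d * A ^ (d / 2) := by
        rw [Real.mul_rpow (by positivity) hA.le, ← Real.rpow_natCast s 2, ← Real.rpow_mul hs0.le]
        congr 2; push_cast; ring
  have h3 : A ^ p ≤ s ^ d * B ^ p := by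
    rw [Real.rpow_add hA, Real.rpow_add hB] at h1
    have hAd : 0 < A ^ (d / 2) := by positivity
    have hBp : 0 < B ^ p := by positivity
    have : A ^ p * A ^ (d / 2) ≤ (s ^ d * B ^ p) * A ^ (d / 2) := by
      calc _ ≤ _ := h1
        _ ≤ B ^ p * (s ^ d * A ^ (d / 2)) := by gcongr
        _ = _ := by ring
    exact le_of_mul_le_mul_right this hAd
  have h4 : t ^ 2 ≤ s ^ (-2 : ℝ) * B := by
    have : s ^ (-2 : ℝ) = (s ^ 2)⁻¹ := by
      rw [Real.rpow_neg hs0.le]; norm_cast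
    rw [this, inv_mul_eq_div, le_div_iff₀ (by positivity)]
    show t ^ 2 * s ^ 2 ≤ 1 + (s * t) ^ 2
    nlinarith
  calc t ^ 2 * A ^ p ≤ (s ^ (-2 : ℝ) * B) * (s ^ d * B ^ p) := by gcongr
    _ = s ^ (d - 2) * B ^ (p + 1) := by
      rw [Real.rpow_add hB, Real.rpow_one, sub_eq_add_neg, Real.rpow_add hs0]; ring

/-- The constant in Hardy's inequality. -/
noncomputable def hardyC : ℝ≥0∞ := ∫⁻ s in Set.Ici (1 : ℝ), ENNReal.ofReal (s ^ (-(3 / 2) : ℝ))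

lemma hardyC_ne_top : hardyC ≠ ⊤ := by
  unfold hardyC
  have h := (integrableOn_Ioi_rpow_of_lt (a := (-(3 / 2) : ℝ)) (by norm_num) (c := 1) (by norm_num))
  rw [← integrableOn_Ici_iff_integrableOn_Ioi] at h
  exact h.lintegral_lt_top.ne

lemma aux_scale (n : ℕ) (s : ℝ) (hs : 1 ≤ s) (G : EuclideanSpace ℝ (Fin n) → ℝ≥0∞)
    (hG : Measurable G) :
    ∫⁻ z, G (s • z) = ENNReal.ofReal (s ^ (-(n : ℝ))) * ∫⁻ z, G z := by
  have hs0 : 0 < s := by linarith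
  have h := Measure.map_addHaar_smul (volume : Measure (EuclideanSpace ℝ (Fin n))) hs0.ne'
  rw [← lintegral_map hG (measurable_const_smul s), h, lintegral_smul_measure, smul_eq_mul,
    finrank_euclideanSpace_fin, abs_of_nonneg (by positivity), Real.rpow_neg hs0.le,
    Real.rpow_natCast]

lemma aux_ray {n : ℕ} {F : Type*} [NormedAddCommGroup F] [NormedSpace ℝ F]
    (v : EuclideanSpace ℝ (Fin n) → F) (hv : ContDiff ℝ 1 v) (hc : HasCompactSupport v)
    (z : EuclideanSpace ℝ (Fin n)) (hz : z ≠ 0) :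
    ‖v z‖ₑ ^ 2 ≤ hardyC * ∫⁻ s in Set.Ici (1 : ℝ),
      ENNReal.ofReal (s ^ (3 / 2 : ℝ)) * (‖fderiv ℝ v (s • z)‖ₑ ^ 2 * ‖z‖ₑ ^ 2) := by
  have h1 := aux_ici (f := fun s : ℝ => v (s • z)) (hv.comp (by fun_prop))
    (hc.comp_isClosedEmbedding (isClosedEmbedding_smul_left hz)) 1
  rw [one_smul] at h1
  have hcont : Continuous (fderiv ℝ v) := hv.continuous_fderiv one_ne_zero
  have h2 : ‖v z‖ₑ ≤ ∫⁻ s in Set.Ici (1 : ℝ), ENNReal.ofReal (s ^ (-(3 / 4) : ℝ)) *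
      (ENNReal.ofReal (s ^ (3 / 4 : ℝ)) * (‖fderiv ℝ v (s • z)‖ₑ * ‖z‖ₑ)) := by
    refine h1.trans (setLIntegral_mono' measurableSet_Ici fun s hs => ?_)
    have hs0 : 0 < s := lt_of_lt_of_le one_pos hs
    have hd : HasDerivAt (fun s : ℝ => v (s • z)) (fderiv ℝ v (s • z) z) s := by
      have := ((hv.differentiable one_ne_zero (s • z)).hasFDerivAt).comp_hasDerivAt s
        ((hasDerivAt_id s).smul_const z)
      simpa using! this
    rw [hd.deriv, ← mul_assoc, ← ENNReal.ofReal_mul (by positivity), ← Real.rpow_add hs0]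
    norm_num
    exact ContinuousLinearMap.le_opENorm _ _
  have hm : Measurable fun s : ℝ => ‖fderiv ℝ v (s • z)‖ₑ :=
    (hcont.comp (by fun_prop)).enorm.measurable
  calc ‖v z‖ₑ ^ 2 ≤ _ := pow_le_pow_left' h2 2
    _ ≤ _ := aux_cs_s11 _ _ _ (by fun_prop) (by fun_prop)
    _ = _ := by
      unfold hardyC
      congr 1
      · refine setLIntegral_congr_fun measurableSet_Ici fun s hs => ?_
        have hs0 : 0 < s := lt_of_lt_of_le one_pos hs
        rw [← ENNReal.ofReal_pow (by positivity), ← Real.rpow_natCast, ← Real.rpow_mul hs0.le]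
        norm_num
      · refine setLIntegral_congr_fun measurableSet_Ici fun s hs => ?_
        have hs0 : 0 < s := lt_of_lt_of_le one_pos hs
        rw [mul_pow, mul_pow, ← ENNReal.ofReal_pow (by positivity), ← Real.rpow_natCast,
          ← Real.rpow_mul hs0.le]
        norm_num

lemma aux_hardy {n : ℕ} (hn : 1 ≤ n) {F : Type*} [NormedAddCommGroup F] [NormedSpace ℝ F]
    (v : EuclideanSpace ℝ (Fin n) → F) (hv : ContDiff ℝ 1 v) (hc : HasCompactSupport v)
    (p : ℝ) (hp : 0 ≤ p + ((n : ℝ) - 1) / 2) :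
    ∫⁻ z, ‖v z‖ₑ ^ 2 * ENNReal.ofReal ((1 + ‖z‖ ^ 2) ^ p) ≤
      hardyC ^ 2 * ∫⁻ z, ‖fderiv ℝ v z‖ₑ ^ 2 * ENNReal.ofReal ((1 + ‖z‖ ^ 2) ^ (p + 1)) := by
  have hnt : Nontrivial (EuclideanSpace ℝ (Fin n)) := by
    have : Nonempty (Fin n) := ⟨⟨0, hn⟩⟩
    infer_instance
  have hcont : Continuous (fderiv ℝ v) := hv.continuous_fderiv one_ne_zero
  have hm0 : Measurable fun z => ‖fderiv ℝ v z‖ₑ := hcont.enorm.measurable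
  have hm : Measurable fun x : EuclideanSpace ℝ (Fin n) × ℝ => ‖fderiv ℝ v (x.2 • x.1)‖ₑ :=
    (hcont.comp (by fun_prop)).enorm.measurable
  set G : EuclideanSpace ℝ (Fin n) → ℝ≥0∞ := fun z =>
    ‖fderiv ℝ v z‖ₑ ^ 2 * ENNReal.ofReal ((1 + ‖z‖ ^ 2) ^ (p + 1)) with hG
  have hGm : Measurable G := by fun_prop
  have hm1 : Measurable (Function.uncurry fun (z : EuclideanSpace ℝ (Fin n)) (s : ℝ) =>
      ENNReal.ofReal (s ^ (3 / 2 : ℝ)) * (‖fderiv ℝ v (s • z)‖ₑ ^ 2 * ‖z‖ₑ ^ 2) *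
        ENNReal.ofReal ((1 + ‖z‖ ^ 2) ^ p)) := by
    unfold Function.uncurry
    fun_prop
  calc ∫⁻ z, ‖v z‖ₑ ^ 2 * ENNReal.ofReal ((1 + ‖z‖ ^ 2) ^ p)
      ≤ ∫⁻ z, hardyC * ∫⁻ s in Set.Ici (1 : ℝ),
        ENNReal.ofReal (s ^ (3 / 2 : ℝ)) * (‖fderiv ℝ v (s • z)‖ₑ ^ 2 * ‖z‖ₑ ^ 2) *
          ENNReal.ofReal ((1 + ‖z‖ ^ 2) ^ p) := by
        apply lintegral_mono_ae
        have : ∀ᵐ z : EuclideanSpace ℝ (Fin n), z ≠ 0 := by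
          simp [ae_iff]
        filter_upwards [this] with z hz
        rw [lintegral_mul_const' _ _ ENNReal.ofReal_ne_top, ← mul_assoc]
        gcongr
        exact aux_ray v hv hc z hz
    _ = hardyC * ∫⁻ s in Set.Ici (1 : ℝ), ∫⁻ z,
        ENNReal.ofReal (s ^ (3 / 2 : ℝ)) * (‖fderiv ℝ v (s • z)‖ₑ ^ 2 * ‖z‖ₑ ^ 2) *
          ENNReal.ofReal ((1 + ‖z‖ ^ 2) ^ p) := by
        rw [lintegral_const_mul' _ _ hardyC_ne_top, lintegral_lintegral_swap hm1.aemeasurable]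
    _ ≤ hardyC * ∫⁻ s in Set.Ici (1 : ℝ), ENNReal.ofReal (s ^ (-(3 / 2) : ℝ)) * ∫⁻ z, G z := by
        refine mul_le_mul_right (setLIntegral_mono' measurableSet_Ici fun s hs => ?_) _
        have hs0 : 0 < s := lt_of_lt_of_le one_pos hs
        calc _ ≤ ∫⁻ z, ENNReal.ofReal (s ^ ((n : ℝ) - 3 / 2)) * G (s • z) := by
              refine lintegral_mono fun z => ?_
              have hw := aux_weight ((n : ℝ) - 1) p s ‖z‖
                (by have : (1 : ℝ) ≤ n := by exact_mod_cast hn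
                    linarith) hp hs
              have hw2 : ENNReal.ofReal (s ^ (3 / 2 : ℝ)) * (‖z‖ₑ ^ 2 *
                  ENNReal.ofReal ((1 + ‖z‖ ^ 2) ^ p)) ≤ ENNReal.ofReal (s ^ ((n : ℝ) - 3 / 2)) *
                  ENNReal.ofReal ((1 + ‖s • z‖ ^ 2) ^ (p + 1)) := by
                rw [← ofReal_norm, ← ENNReal.ofReal_pow (norm_nonneg z),
                  ← ENNReal.ofReal_mul (by positivity), ← ENNReal.ofReal_mul (by positivity),
                  ← ENNReal.ofReal_mul (by positivity), norm_smul, Real.norm_of_nonneg hs0.le]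
                apply ENNReal.ofReal_le_ofReal
                calc _ ≤ s ^ (3 / 2 : ℝ) * (s ^ ((n : ℝ) - 1 - 2) *
                      (1 + (s * ‖z‖) ^ 2) ^ (p + 1)) := by gcongr
                  _ = _ := by
                    rw [← mul_assoc, ← Real.rpow_add hs0]; congr 2; ring
              calc _ = ‖fderiv ℝ v (s • z)‖ₑ ^ 2 * (ENNReal.ofReal (s ^ (3 / 2 : ℝ)) * (‖z‖ₑ ^ 2 *
                  ENNReal.ofReal ((1 + ‖z‖ ^ 2) ^ p))) := by ring
                _ ≤ ‖fderiv ℝ v (s • z)‖ₑ ^ 2 * (ENNReal.ofReal (s ^ ((n : ℝ) - 3 / 2)) *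
                  ENNReal.ofReal ((1 + ‖s • z‖ ^ 2) ^ (p + 1))) := by gcongr
                _ = _ := by simp only [hG]; ring
          _ = _ := by
            rw [lintegral_const_mul' _ _ ENNReal.ofReal_ne_top, aux_scale n s hs G hGm, ← mul_assoc,
              ← ENNReal.ofReal_mul (by positivity), ← Real.rpow_add hs0]
            congr 3; ring
    _ = _ := by
        rw [lintegral_mul_const _ (by fun_prop), sq, mul_assoc]; rfl

/-- The squared weighted norm as an extended nonnegative integral. -/
noncomputable def Qsq (n i : ℕ) (u : EuclideanSpace ℝ (Fin n) → ℝ) : ℝ≥0∞ :=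
  ∫⁻ z, ‖iteratedFDeriv ℝ i u z‖ₑ ^ 2 *
    ENNReal.ofReal ((1 + ‖z‖ ^ 2) ^ ((i : ℝ) + (1 - (n : ℝ)) / 2))

lemma Qsq_succ {n : ℕ} (hn : 1 ≤ n) (i : ℕ) (u : EuclideanSpace ℝ (Fin n) → ℝ)
    (hu : ContDiff ℝ (⊤ : ℕ∞) u) (hc : HasCompactSupport u) :
    Qsq n i u ≤ hardyC ^ 2 * Qsq n (i + 1) u := by
  have hD : ContDiff ℝ 1 (iteratedFDeriv ℝ i u) :=
    hu.iteratedFDeriv_right (by exact_mod_cast le_top)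
  have h := aux_hardy hn (iteratedFDeriv ℝ i u) hD (hc.iteratedFDeriv i)
    ((i : ℝ) + (1 - (n : ℝ)) / 2) (by
      have : (0 : ℝ) ≤ i := by positivity
      linarith)
  refine h.trans (le_of_eq ?_)
  unfold Qsq
  congr 2
  ext z
  have e : ‖fderiv ℝ (iteratedFDeriv ℝ i u) z‖ₑ = ‖iteratedFDeriv ℝ (i + 1) u z‖ₑ := by
    rw [← ofReal_norm, ← ofReal_norm, norm_fderiv_iteratedFDeriv]
  rw [e]
  congr 3
  push_cast; ring

lemma Qsq_le {n : ℕ} (hn : 1 ≤ n) (i m : ℕ) (u : EuclideanSpace ℝ (Fin n) → ℝ)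
    (hu : ContDiff ℝ (⊤ : ℕ∞) u) (hc : HasCompactSupport u) :
    Qsq n i u ≤ (hardyC ^ 2) ^ m * Qsq n (i + m) u := by
  induction m with
  | zero => simp
  | succ m ih =>
    refine ih.trans ?_
    rw [pow_succ (hardyC ^ 2) m, mul_assoc]
    gcongr
    exact Qsq_succ hn (i + m) u hu hc

lemma Qsq_le' {n : ℕ} (hn : 1 ≤ n) (i k : ℕ) (hik : i ≤ k) (u : EuclideanSpace ℝ (Fin n) → ℝ)
    (hu : ContDiff ℝ (⊤ : ℕ∞) u) (hc : HasCompactSupport u) :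
    Qsq n i u ≤ (1 + hardyC ^ 2) ^ k * Qsq n k u := by
  obtain ⟨m, rfl⟩ := Nat.exists_eq_add_of_le hik
  refine (Qsq_le hn i m u hu hc).trans ?_
  refine mul_le_mul_left ?_ _
  calc (hardyC ^ 2) ^ m ≤ (1 + hardyC ^ 2) ^ m := by gcongr; exact le_add_self
    _ ≤ (1 + hardyC ^ 2) ^ (i + m) := pow_le_pow_right₀ le_self_add (by omega)

/-- The constant in the Sobolev embedding. -/
noncomputable def sobC (n : ℕ) : ℝ≥0∞ :=
  ∫⁻ z : EuclideanSpace ℝ (Fin n), ENNReal.ofReal ((1 + ‖z‖ ^ 2) ^ (-((n : ℝ) + 1) / 2))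

lemma sobC_ne_top (n : ℕ) : sobC n ≠ ⊤ := by
  have h := integrable_rpow_neg_one_add_norm_sq (E := EuclideanSpace ℝ (Fin n))
    (μ := volume) (r := (n : ℝ) + 1) (by rw [finrank_euclideanSpace_fin]; linarith)
  exact h.lintegral_lt_top.ne

lemma sob (n j : ℕ) (u : EuclideanSpace ℝ (Fin n) → ℝ)
    (hu : ContDiff ℝ (⊤ : ℕ∞) u) (hc : HasCompactSupport u) (x : EuclideanSpace ℝ (Fin n)) :
    ENNReal.ofReal ((1 + ‖x‖ ^ 2) ^ (j : ℝ)) * ‖iteratedFDeriv ℝ j u x‖ₑ ^ 2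
      ≤ sobC n * Qsq n (j + n) u := by
  have h := aux_sup n j ((j : ℝ) / 2) (by positivity) u hu hc x
  have hD : Continuous (iteratedFDeriv ℝ (j + n) u) :=
    hu.continuous_iteratedFDeriv (by exact_mod_cast le_top)
  have hm : Measurable fun z => ‖iteratedFDeriv ℝ (j + n) u z‖ₑ := hD.enorm.measurable
  have e1 : ∀ (q : ℝ) (z : EuclideanSpace ℝ (Fin n)), ENNReal.ofReal ((1 + ‖z‖ ^ 2) ^ (q / 2)) ^ 2
      = ENNReal.ofReal ((1 + ‖z‖ ^ 2) ^ q) := by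
    intro q z
    rw [← ENNReal.ofReal_pow (by positivity), ← Real.rpow_natCast, ← Real.rpow_mul (by positivity)]
    congr 2; push_cast; ring
  have e2 : ∀ (a b : ℝ) (z : EuclideanSpace ℝ (Fin n)), ENNReal.ofReal ((1 + ‖z‖ ^ 2) ^ (a + b))
      = ENNReal.ofReal ((1 + ‖z‖ ^ 2) ^ a) * ENNReal.ofReal ((1 + ‖z‖ ^ 2) ^ b) := by
    intro a b z
    rw [← ENNReal.ofReal_mul (by positivity), Real.rpow_add (by positivity)]
  calc _ = (ENNReal.ofReal ((1 + ‖x‖ ^ 2) ^ ((j : ℝ) / 2)) * ‖iteratedFDeriv ℝ j u x‖ₑ) ^ 2 := by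
        rw [mul_pow, e1]
    _ ≤ (∫⁻ z, ENNReal.ofReal ((1 + ‖z‖ ^ 2) ^ ((j : ℝ) / 2)) *
          ‖iteratedFDeriv ℝ (j + n) u z‖ₑ) ^ 2 := pow_le_pow_left' h 2
    _ = (∫⁻ z, ENNReal.ofReal ((1 + ‖z‖ ^ 2) ^ ((-((n : ℝ) + 1) / 2) / 2)) *
          (ENNReal.ofReal ((1 + ‖z‖ ^ 2) ^ ((((j + n : ℕ) : ℝ) + (1 - (n : ℝ)) / 2) / 2)) *
          ‖iteratedFDeriv ℝ (j + n) u z‖ₑ)) ^ 2 := by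
        congr 2
        ext z
        rw [← mul_assoc, ← e2]
        congr 3
        push_cast; ring
    _ ≤ _ := aux_cs_s11 _ _ _ (by fun_prop) (by fun_prop)
    _ = _ := by
        unfold sobC Qsq
        congr 1
        · simp only [e1]
        · congr 1
          ext z
          rw [mul_pow, e1, mul_comm]

lemma Qnorm_sq (n i : ℕ) (u : EuclideanSpace ℝ (Fin n) → ℝ)
    (hu : ContDiff ℝ (⊤ : ℕ∞) u) (hc : HasCompactSupport u) :
    Qsq n i u = ENNReal.ofReal (Qnorm n i u ^ 2) := by
  have hD : Continuous (iteratedFDeriv ℝ i u) :=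
    hu.continuous_iteratedFDeriv (by exact_mod_cast le_top)
  have hs := hc.iteratedFDeriv (𝕜 := ℝ) i
  have hint : Integrable (fun z : EuclideanSpace ℝ (Fin n) => ‖iteratedFDeriv ℝ i u z‖ ^ 2 *
      (1 + ‖z‖ ^ 2) ^ ((i : ℝ) + (1 - (n : ℝ)) / 2)) := by
    apply Continuous.integrable_of_hasCompactSupport
    · refine (hD.norm.pow 2).mul (Continuous.rpow_const (by fun_prop) fun z => Or.inl (by positivity))
    · refine HasCompactSupport.mul_right ?_
      exact hs.comp_left (g := fun T => ‖T‖ ^ 2) (by simp)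
  unfold Qnorm Qsq
  rw [← Real.rpow_natCast, ← Real.rpow_mul (integral_nonneg fun z => by positivity)]
  norm_num
  rw [ofReal_integral_eq_lintegral_ofReal hint (Filter.Eventually.of_forall fun z => by positivity)]
  congr 1
  ext z
  rw [ENNReal.ofReal_mul (by positivity), ENNReal.ofReal_pow (norm_nonneg _), ofReal_norm]

lemma Qnorm_nonneg (n i : ℕ) (u : EuclideanSpace ℝ (Fin n) → ℝ) : 0 ≤ Qnorm n i u :=
  Real.rpow_nonneg (integral_nonneg fun z => by positivity) _

lemma aux_rho (n k : ℕ) (hnk : n ≤ 2 * k) (t : ℝ) (ht : 0 ≤ t) :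
    1 + ((10 : ℝ) ^ (3 * k))⁻¹ * t ^ (2 * k + 1 - n)
      ≤ 2 * (1 + t ^ 2) ^ ((k : ℝ) + (1 - (n : ℝ)) / 2) := by
  have hA : 1 ≤ 1 + t ^ 2 := by nlinarith
  have hnk' : (n : ℝ) ≤ 2 * k := by exact_mod_cast hnk
  have h1 : (1 : ℝ) ≤ (1 + t ^ 2) ^ ((k : ℝ) + (1 - (n : ℝ)) / 2) :=
    Real.one_le_rpow hA (by linarith)
  have h10 : ((10 : ℝ) ^ (3 * k))⁻¹ ≤ 1 := inv_le_one_of_one_le₀ (one_le_pow₀ (by norm_num))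
  have h2 : t ^ (2 * k + 1 - n) ≤ (1 + t ^ 2) ^ ((k : ℝ) + (1 - (n : ℝ)) / 2) := by
    calc t ^ (2 * k + 1 - n) = (t ^ 2) ^ ((k : ℝ) + (1 - (n : ℝ)) / 2) := by
          rw [← Real.rpow_natCast, ← Real.rpow_natCast, ← Real.rpow_mul ht]
          rw [Nat.cast_sub (by omega)]
          congr 1; push_cast; ring
      _ ≤ _ := Real.rpow_le_rpow (by positivity) (by linarith) (by linarith)
  have h3 : ((10 : ℝ) ^ (3 * k))⁻¹ * t ^ (2 * k + 1 - n) ≤ 1 * t ^ (2 * k + 1 - n) := by gcongr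
  linarith

/-- Nonlinear estimate: with `ρ_k(z) = 1 + 10^{-3k}|z|^{2k+1-n}` and `k = 2n+10`,
`‖∇^{k-j}u · ∇ʲu‖_{L²(ρ_k)} ≤ C (‖u‖_{Q_k} + ‖u‖_{Q_0})²` for all `0 ≤ j ≤ k/2`. -/
theorem nonlinear_estimate (n : ℕ) (hn : 1 ≤ n) (k : ℕ) (hk : k = 2 * n + 10) :
    ∃ C > 0, ∀ j, j ≤ k / 2 → ∀ u : EuclideanSpace ℝ (Fin n) → ℝ,
      ContDiff ℝ (⊤ : ℕ∞) u → HasCompactSupport u →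
      (∫ z : EuclideanSpace ℝ (Fin n),
          (‖iteratedFDeriv ℝ (k - j) u z‖ * ‖iteratedFDeriv ℝ j u z‖) ^ 2 *
            (1 + ((10 : ℝ) ^ (3 * k))⁻¹ * ‖z‖ ^ (2 * k + 1 - n))) ^ ((1 : ℝ) / 2)
        ≤ C * (Qnorm n k u + Qnorm n 0 u) ^ 2 := by
  set K : ℝ≥0∞ := 2 * (sobC n * ((1 + hardyC ^ 2) ^ k * (1 + hardyC ^ 2) ^ k)) with hK
  have hKt : K ≠ ⊤ := by
    have h1 := sobC_ne_top n
    have h2 : (1 + hardyC ^ 2) ^ k ≠ ⊤ :=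
      ENNReal.pow_ne_top (ENNReal.add_ne_top.2 ⟨by simp, ENNReal.pow_ne_top hardyC_ne_top⟩)
    exact ENNReal.mul_ne_top (by simp) (ENNReal.mul_ne_top h1 (ENNReal.mul_ne_top h2 h2))
  refine ⟨(K.toReal) ^ ((1 : ℝ) / 2) + 1, by positivity, ?_⟩
  intro j hj u hu hc
  have hq := Qnorm_nonneg n k u
  have hq0 := Qnorm_nonneg n 0 u
  set L := ∫ z : EuclideanSpace ℝ (Fin n),
          (‖iteratedFDeriv ℝ (k - j) u z‖ * ‖iteratedFDeriv ℝ j u z‖) ^ 2 *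
            (1 + ((10 : ℝ) ^ (3 * k))⁻¹ * ‖z‖ ^ (2 * k + 1 - n)) with hL
  have hD : ∀ i, Continuous (iteratedFDeriv ℝ i u) := fun i =>
    hu.continuous_iteratedFDeriv (by exact_mod_cast le_top)
  have hLn : L = ENNReal.toReal (∫⁻ z : EuclideanSpace ℝ (Fin n), ENNReal.ofReal (
          (‖iteratedFDeriv ℝ (k - j) u z‖ * ‖iteratedFDeriv ℝ j u z‖) ^ 2 *
            (1 + ((10 : ℝ) ^ (3 * k))⁻¹ * ‖z‖ ^ (2 * k + 1 - n)))) := by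
    apply integral_eq_lintegral_of_nonneg_ae (Filter.Eventually.of_forall fun z => by positivity)
    have h1 := hD (k - j)
    have h2 := hD j
    exact Continuous.aestronglyMeasurable (by fun_prop)
  have key : (∫⁻ z : EuclideanSpace ℝ (Fin n), ENNReal.ofReal (
          (‖iteratedFDeriv ℝ (k - j) u z‖ * ‖iteratedFDeriv ℝ j u z‖) ^ 2 *
            (1 + ((10 : ℝ) ^ (3 * k))⁻¹ * ‖z‖ ^ (2 * k + 1 - n))))
        ≤ K * (Qsq n k u * Qsq n k u) := by
    have hst : sobC n * Qsq n (j + n) u ≠ ⊤ := by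
      rw [Qnorm_sq n (j + n) u hu hc]
      exact ENNReal.mul_ne_top (sobC_ne_top n) ENNReal.ofReal_ne_top
    calc _ ≤ ∫⁻ z, (2 * (sobC n * Qsq n (j + n) u)) * (‖iteratedFDeriv ℝ (k - j) u z‖ₑ ^ 2 *
            ENNReal.ofReal ((1 + ‖z‖ ^ 2) ^ (((k - j : ℕ) : ℝ) + (1 - (n : ℝ)) / 2))) := by
          refine lintegral_mono fun z => ?_
          have hs := sob n j u hu hc z
          have hr := aux_rho n k (by omega) ‖z‖ (norm_nonneg z)
          have hexp : (1 + ‖z‖ ^ 2) ^ ((k : ℝ) + (1 - (n : ℝ)) / 2) = (1 + ‖z‖ ^ 2) ^ (j : ℝ) *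
              (1 + ‖z‖ ^ 2) ^ (((k - j : ℕ) : ℝ) + (1 - (n : ℝ)) / 2) := by
            rw [← Real.rpow_add (by positivity), Nat.cast_sub (by omega)]
            congr 1; ring
          rw [hexp] at hr
          calc _ ≤ ENNReal.ofReal ((‖iteratedFDeriv ℝ (k - j) u z‖ * ‖iteratedFDeriv ℝ j u z‖) ^ 2 *
                (2 * ((1 + ‖z‖ ^ 2) ^ (j : ℝ) *
              (1 + ‖z‖ ^ 2) ^ (((k - j : ℕ) : ℝ) + (1 - (n : ℝ)) / 2)))) := by
                apply ENNReal.ofReal_le_ofReal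
                gcongr
            _ = 2 * (ENNReal.ofReal ((1 + ‖z‖ ^ 2) ^ (j : ℝ)) * ‖iteratedFDeriv ℝ j u z‖ₑ ^ 2) *
                (‖iteratedFDeriv ℝ (k - j) u z‖ₑ ^ 2 *
            ENNReal.ofReal ((1 + ‖z‖ ^ 2) ^ (((k - j : ℕ) : ℝ) + (1 - (n : ℝ)) / 2))) := by
                rw [ENNReal.ofReal_mul (by positivity), ENNReal.ofReal_pow (by positivity),
                  ENNReal.ofReal_mul (by positivity), ENNReal.ofReal_mul (by positivity),
                  ENNReal.ofReal_mul (by positivity), ofReal_norm, ofReal_norm,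
                  ENNReal.ofReal_ofNat]
                ring
            _ ≤ _ := by gcongr
      _ = (2 * (sobC n * Qsq n (j + n) u)) * Qsq n (k - j) u := by
          rw [lintegral_const_mul' _ _ (ENNReal.mul_ne_top (by simp) hst)]; rfl
      _ ≤ (2 * (sobC n * ((1 + hardyC ^ 2) ^ k * Qsq n k u))) *
            ((1 + hardyC ^ 2) ^ k * Qsq n k u) := by
          gcongr
          · exact Qsq_le' hn _ _ (by omega) u hu hc
          · exact Qsq_le' hn _ _ (by omega) u hu hc
      _ = _ := by rw [hK]; ring
  rw [Qnorm_sq n k u hu hc] at key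
  have hL2 : L ≤ K.toReal * (Qnorm n k u ^ 2) ^ 2 := by
    rw [hLn]
    have := ENNReal.toReal_mono (ENNReal.mul_ne_top hKt
      (ENNReal.mul_ne_top ENNReal.ofReal_ne_top ENNReal.ofReal_ne_top)) key
    refine this.trans (le_of_eq ?_)
    rw [ENNReal.toReal_mul (a := K), ENNReal.toReal_mul (a := ENNReal.ofReal _),
      ENNReal.toReal_ofReal (by positivity)]
    ring
  have hL0 : 0 ≤ L := integral_nonneg fun z => by positivity
  calc L ^ ((1 : ℝ) / 2) ≤ (K.toReal * (Qnorm n k u ^ 2) ^ 2) ^ ((1 : ℝ) / 2) :=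
        Real.rpow_le_rpow hL0 hL2 (by norm_num)
    _ = K.toReal ^ ((1 : ℝ) / 2) * Qnorm n k u ^ 2 := by
        rw [Real.mul_rpow (by positivity) (by positivity), ← Real.sqrt_eq_rpow ((Qnorm n k u ^ 2) ^ 2),
          Real.sqrt_sq (by positivity)]
    _ ≤ (K.toReal ^ ((1 : ℝ) / 2) + 1) * (Qnorm n k u + Qnorm n 0 u) ^ 2 := by
        gcongr
        · linarith
        · linarith
end
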